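/- arXiv:1204.0432 — 3 statements merged into one kernel-verified Lean document; each statement's English description precedes it below -/
import Mathlib

section
/- Let P be a group carrying a compact Hausdorff topology such that every right translation ρ_a : P → P, x ↦ x·a, is continuous and the topological center Λ(P) = {a ∈ P : the left translation λ_a is continuous} is dense in P. If P is a Fréchet–Urysohn topological space, then P is a topological group: multiplication P × P → P is jointly continuous and inversion P → P is continuous. -/
section RightTopologicalGroup

open Filter Topology Set

/-- A fixed-point free continuous self-map of a compact Hausdorff space moves every point by at
least `1` with respect to finitely many continuous real functions. -/
theorem exists_continuous_one_le_dist {X : Type*} [TopologicalSpace X] [CompactSpace X]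
    [T2Space X] {r : X → X} (hr : Continuous r) (hne : ∀ x, r x ≠ x) :
    ∃ (t : Finset C(X, ℝ)) (F : X → (t → ℝ)), Continuous F ∧ ∀ x, 1 ≤ dist (F x) (F (r x)) := by
  have hcover : (univ : Set X) ⊆ ⋃ f : C(X, ℝ), {x | 1 / 2 < dist (f x) (f (r x))} := by
    intro x _
    obtain ⟨f, h0, h1, -⟩ := exists_continuous_zero_one_of_isClosed (isClosed_singleton (x := x))
      (isClosed_singleton (x := r x)) (by simpa using (hne x).symm)
    refine mem_iUnion.2 ⟨f, ?_⟩
    have h0 : f x = 0 := h0 rfl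
    have h1 : f (r x) = 1 := h1 rfl
    simp only [mem_ofPred_eq, h0, h1]
    norm_num
  obtain ⟨t, ht⟩ := isCompact_univ.elim_finite_subcover _
    (fun f : C(X, ℝ) => isOpen_lt continuous_const (by fun_prop)) hcover
  refine ⟨t, fun x f => 2 * f.1 x, by fun_prop, fun x => ?_⟩
  obtain ⟨f, hf, hx⟩ := mem_iUnion₂.1 (ht (mem_univ x))
  refine le_trans ?_ (dist_le_pi_dist _ _ ⟨f, hf⟩)
  have hx : 1 / 2 < dist (f x) (f (r x)) := hx
  rw [Real.dist_eq] at hx ⊢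
  rw [← mul_sub, abs_mul, abs_two]
  linarith

variable {P : Type*} [Group P] [TopologicalSpace P]

theorem continuous_const_mul_of_continuous_inv (hright : ∀ a : P, Continuous fun x : P => x * a)
    (hinv : Continuous fun x : P => x⁻¹) (a : P) : Continuous fun x : P => a * x := by
  simpa [Function.comp_def] using hinv.comp ((hright a⁻¹).comp hinv)

section Separable

variable [CompactSpace P] [FrechetUrysohnSpace P]

/-- Each left translation, being a pointwise limit of a sequence of continuous ones, has small
oscillation on a nonempty open set taken from a countable family not depending on it. -/
theorem exists_countable_family_dist_le (hright : ∀ a : P, Continuous fun x : P => x * a)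
    {H : Set P} (hcount : H.Countable) (hdense : Dense H)
    (hleft : ∀ a ∈ H, Continuous fun x : P => a * x)
    {M : Type*} [MetricSpace M] [SecondCountableTopology M] {F : P → M} (hF : Continuous F)
    {ε : ℝ} (hε : 0 < ε) :
    ∃ 𝒲 : Set (Set P), 𝒲.Countable ∧ (∀ W ∈ 𝒲, IsOpen W ∧ W.Nonempty) ∧
      ∀ a : P, ∃ W ∈ 𝒲, ∀ y ∈ W, ∀ y' ∈ W, dist (F (a * y)) (F (a * y')) ≤ ε := by
  have : Countable H := hcount.to_subtype
  let π : P → (H → M) := fun x h => F (h.1 * x)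
  have hπ : Continuous π := continuous_pi fun h => hF.comp (hleft h.1 h.2)
  let q : P → range π := rangeFactorization π
  have hq : Continuous q := hπ.subtype_mk _
  have : CompactSpace (range π) := isCompact_iff_compactSpace.1 (isCompact_range hπ)
  refine ⟨(fun V => q ⁻¹' V) '' TopologicalSpace.countableBasis (range π),
    (TopologicalSpace.countable_countableBasis _).image _, ?_, fun a => ?_⟩
  · rintro _ ⟨V, hV, rfl⟩
    refine ⟨(TopologicalSpace.isOpen_of_mem_countableBasis hV).preimage hq, ?_⟩
    exact (TopologicalSpace.nonempty_of_mem_countableBasis hV).preimage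
      rangeFactorization_surjective
  · obtain ⟨u, hu, hua⟩ := mem_closure_iff_seq_limit.1 (hdense a)
    have hlim : ∀ y, Tendsto (fun n => F (u n * y)) atTop (𝓝 (F (a * y))) := fun y =>
      ((hF.comp (hright y)).tendsto a).comp hua
    have hev : ∀ n, Continuous fun y : range π => y.1 ⟨u n, hu n⟩ := fun n =>
      (continuous_apply _).comp continuous_subtype_val
    let E : ℕ → Set (range π) := fun N =>
      {y | ∀ m ≥ N, dist (y.1 ⟨u m, hu m⟩) (y.1 ⟨u N, hu N⟩) ≤ ε / 4}
    have hE : ∀ N, IsClosed (E N) := fun N => by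
      have : E N = ⋂ m, ⋂ (_ : m ≥ N), {y | dist (y.1 ⟨u m, hu m⟩) (y.1 ⟨u N, hu N⟩) ≤ ε / 4} := by
        ext; simp [E]
      rw [this]
      exact isClosed_iInter fun m => isClosed_iInter fun _ =>
        isClosed_le ((hev m).dist (hev N)) continuous_const
    have hEU : ⋃ N, E N = univ := by
      refine eq_univ_of_forall ?_
      rintro ⟨_, y, rfl⟩
      obtain ⟨N, hN⟩ := Metric.cauchySeq_iff'.1 (hlim y).cauchySeq (ε / 4) (by positivity)
      exact mem_iUnion.2 ⟨N, fun m hm => (hN m hm).le⟩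
    have : Nonempty (range π) := ⟨q 1⟩
    obtain ⟨N, z, hz⟩ := nonempty_interior_of_iUnion_of_closed hE hEU
    have hball : {y : range π | dist (y.1 ⟨u N, hu N⟩) (z.1 ⟨u N, hu N⟩) < ε / 4} ∈ 𝓝 z :=
      (isOpen_lt ((hev N).dist continuous_const) continuous_const).mem_nhds (by simpa using hε)
    obtain ⟨V, hV, -, hVs⟩ := (TopologicalSpace.isBasis_countableBasis (range π)).mem_nhds_iff.1
      (inter_mem (mem_interior_iff_mem_nhds.1 hz) hball)
    refine ⟨_, ⟨V, hV, rfl⟩, ?_⟩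
    have key : ∀ y ∈ q ⁻¹' V, dist (F (a * y)) (z.1 ⟨u N, hu N⟩) ≤ ε / 2 := by
      intro y hy
      obtain ⟨h1, h2⟩ := hVs hy
      have h3 : dist (F (a * y)) (F (u N * y)) ≤ ε / 4 :=
        le_of_tendsto ((hlim y).dist tendsto_const_nhds) (eventually_atTop.2 ⟨N, h1⟩)
      have h2 : dist (F (u N * y)) (z.1 ⟨u N, hu N⟩) < ε / 4 := h2
      linarith [dist_triangle (F (a * y)) (F (u N * y)) (z.1 ⟨u N, hu N⟩)]
    intro y hy y' hy'
    linarith [key y hy, key y' hy', dist_triangle_right (F (a * y)) (F (a * y')) (z.1 ⟨u N, hu N⟩)]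

variable [T2Space P]

/-- Multiplication composed with a continuous map to a metric space has small oscillation on some
nonempty open rectangle. -/
theorem exists_isOpen_rectangle_dist_le (hright : ∀ a : P, Continuous fun x : P => x * a)
    {H : Set P} (hcount : H.Countable) (hdense : Dense H)
    (hleft : ∀ a ∈ H, Continuous fun x : P => a * x)
    {M : Type*} [MetricSpace M] [SecondCountableTopology M] {F : P → M} (hF : Continuous F)
    {ε : ℝ} (hε : 0 < ε) :
    ∃ U W : Set P, IsOpen U ∧ U.Nonempty ∧ IsOpen W ∧ W.Nonempty ∧
      ∃ c : M, ∀ u ∈ U, ∀ w ∈ W, dist (F (u * w)) c ≤ ε := by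
  obtain ⟨𝒲, h𝒲, hopen, hosc⟩ := exists_countable_family_dist_le hright hcount hdense hleft hF
    (half_pos hε)
  have : Countable 𝒲 := h𝒲.to_subtype
  let B : 𝒲 → Set P := fun W =>
    {a | ∀ y ∈ W.1, ∀ y' ∈ W.1, dist (F (a * y)) (F (a * y')) ≤ ε / 2}
  have hB : ∀ W, IsClosed (B W) := fun W => by
    have : B W = ⋂ y ∈ W.1, ⋂ y' ∈ W.1, {a | dist (F (a * y)) (F (a * y')) ≤ ε / 2} := by
      ext; simp [B]
    rw [this]
    exact isClosed_biInter fun y _ => isClosed_biInter fun y' _ =>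
      isClosed_le ((hF.comp (hright y)).dist (hF.comp (hright y'))) continuous_const
  have hBU : ⋃ W, B W = univ := eq_univ_of_forall fun a => by
    obtain ⟨W, hW, h⟩ := hosc a
    exact mem_iUnion.2 ⟨⟨W, hW⟩, h⟩
  obtain ⟨⟨W, hW⟩, a, ha⟩ := nonempty_interior_of_iUnion_of_closed hB hBU
  obtain ⟨hWo, w, hw⟩ := hopen W hW
  refine ⟨interior (B ⟨W, hW⟩) ∩ {u | dist (F (u * w)) (F (a * w)) < ε / 2}, W,
    isOpen_interior.inter (isOpen_lt ((hF.comp (hright w)).dist continuous_const)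
      continuous_const), ⟨a, ha, by simpa using hε⟩, hWo, ⟨w, hw⟩, F (a * w), ?_⟩
  rintro u ⟨hu, hu'⟩ y hy
  have h1 : dist (F (u * y)) (F (u * w)) ≤ ε / 2 := interior_subset hu y hy w hw
  have hu' : dist (F (u * w)) (F (a * w)) < ε / 2 := hu'
  linarith [dist_triangle (F (u * y)) (F (u * w)) (F (a * w))]

/-- The topology with neighbourhoods `W⁻¹ * W` of the identity is Hausdorff. -/
theorem exists_isOpen_disjoint_quotients (hright : ∀ a : P, Continuous fun x : P => x * a)
    {H : Set P} (hcount : H.Countable) (hdense : Dense H)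
    (hleft : ∀ a ∈ H, Continuous fun x : P => a * x) {g : P} (hg : g ≠ 1) :
    ∃ W : Set P, IsOpen W ∧ W.Nonempty ∧
      ∀ k, ∀ w ∈ W, w * k ∈ W → ∀ w' ∈ W, w' * (k * g⁻¹) ∉ W := by
  obtain ⟨t, F, hF, hdist⟩ := exists_continuous_one_le_dist (hright g)
    (fun x h => hg (by simpa using h))
  obtain ⟨U, W, hU, hUne, hW, hWne, c, hc⟩ := exists_isOpen_rectangle_dist_le hright hcount hdense
    hleft (hF.prodMk (hF.comp (hright g))) (ε := 1 / 4) (by norm_num)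
  have hUW : ∀ u ∈ U, ∀ w ∈ W, ∀ u' ∈ U, ∀ w' ∈ W, u * w ≠ u' * w' * g := by
    intro u hu w hw u' hu' w' hw' h
    have h1 := hc u hu w hw
    have h2 := hc u' hu' w' hw'
    rw [Prod.dist_eq, max_le_iff] at h1 h2
    have h3 := hdist (u' * w')
    simp only [Function.comp] at h1 h2
    have h4 := dist_triangle_right (F (u' * w')) (F (u' * w' * g)) c.1
    rw [← h] at h3 h4
    linarith [h1.1, h2.1]
  have : Countable H := hcount.to_subtype
  have hcover : ⋃ h : H, closure {w | ∃ u ∈ U, u * w = h.1} = univ := by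
    refine eq_univ_of_forall fun w => ?_
    obtain ⟨u, hu⟩ := hUne
    obtain ⟨h, hhU, hhH⟩ := hdense.inter_open_nonempty _ (hU.preimage (hright w⁻¹))
      ⟨u * w, by simpa using hu⟩
    exact mem_iUnion.2 ⟨⟨h, hhH⟩, subset_closure ⟨_, hhU, by simp⟩⟩
  obtain ⟨w₁, hw₁, hw₁'⟩ := (dense_iUnion_interior_of_closed (fun _ => isClosed_closure)
    hcover).inter_open_nonempty W hW hWne
  obtain ⟨h, hw₁'⟩ := mem_iUnion.1 hw₁'
  refine ⟨W ∩ interior (closure {w | ∃ u ∈ U, u * w = h.1}), hW.inter isOpen_interior,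
    ⟨w₁, hw₁, hw₁'⟩, ?_⟩
  set W₁ := W ∩ interior (closure {w | ∃ u ∈ U, u * w = h.1})
  have hW₁ : IsOpen W₁ := hW.inter isOpen_interior
  have hmeet : ∀ l, ∀ w ∈ W₁, w * l ∈ W₁ → ∃ u ∈ U, ∃ v ∈ W, u * v = h.1 ∧ v * l ∈ W := by
    intro l w hw hwl
    obtain ⟨v, ⟨hv, hvl⟩, u, hu, huv⟩ := mem_closure_iff.1 (interior_subset hw.2)
      (W₁ ∩ (fun x => x * l) ⁻¹' W₁) (hW₁.inter (hW₁.preimage (hright l))) ⟨hw, hwl⟩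
    exact ⟨u, hu, v, hv.1, huv, hvl.1⟩
  intro k w hw hwk w' hw' hwk'
  obtain ⟨u, hu, v, -, huv, hvk⟩ := hmeet k w hw hwk
  obtain ⟨u', hu', v', -, huv', hvk'⟩ := hmeet _ w' hw' hwk'
  refine hUW u hu _ hvk u' hu' _ hvk' ?_
  rw [← mul_assoc, huv, ← mul_assoc, huv']
  group

theorem continuous_inv_of_countable_dense (hright : ∀ a : P, Continuous fun x : P => x * a)
    {H : Set P} (hcount : H.Countable) (hdense : Dense H)
    (hleft : ∀ a ∈ H, Continuous fun x : P => a * x) : Continuous fun x : P => x⁻¹ := by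
  refine continuous_iff_ultrafilter.2 fun x₀ G hG => ?_
  obtain ⟨y, -, hy⟩ := isCompact_univ.ultrafilter_le_nhds' (G.map fun x : P => x⁻¹) univ_mem
  have hy : Tendsto (fun x : P => x⁻¹) G (𝓝 y) := hy
  suffices h : y * x₀ = 1 by rwa [← eq_inv_of_mul_eq_one_left h]
  by_contra hg
  obtain ⟨W, hW, ⟨w, hw⟩, hsep⟩ := exists_isOpen_disjoint_quotients hright hcount hdense hleft hg
  obtain ⟨b, hbW, hbH⟩ := hdense.inter_open_nonempty _ (hW.preimage (hright x₀))
    ⟨w * x₀⁻¹, by simpa using hw⟩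
  obtain ⟨c, hcW, hcH⟩ := hdense.inter_open_nonempty W hW ⟨w, hw⟩
  have h1 : ∀ᶠ x in (G : Filter P), b * x ∈ W :=
    (((hleft b hbH).tendsto x₀).mono_left hG).eventually (hW.mem_nhds hbW)
  have h2 : Tendsto (fun x : P => c * (x⁻¹ * x₀ * (y * x₀)⁻¹)) G (𝓝 c) := by
    have := ((hleft c hcH).tendsto _).comp
      (((hright (y * x₀)⁻¹).tendsto _).comp (((hright x₀).tendsto y).comp hy))
    simpa [Function.comp_def] using this
  obtain ⟨x, hx1, hx2⟩ := (h1.and (h2.eventually (hW.mem_nhds hcW))).exists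
  exact hsep (x⁻¹ * x₀) _ hx1 (by simpa [mul_assoc] using hbW) c hcW hx2

theorem continuous_mul_of_countable_dense (hright : ∀ a : P, Continuous fun x : P => x * a)
    {H : Set P} (hcount : H.Countable) (hdense : Dense H)
    (hleft : ∀ a ∈ H, Continuous fun x : P => a * x) :
    Continuous fun p : P × P => p.1 * p.2 := by
  have hinv := continuous_inv_of_countable_dense hright hcount hdense hleft
  have hlt := continuous_const_mul_of_continuous_inv hright hinv
  refine continuous_iff_ultrafilter.2 fun ⟨x₀, y₀⟩ G hG => ?_
  obtain ⟨z, -, hz⟩ := isCompact_univ.ultrafilter_le_nhds' (G.map fun p : P × P => p.1 * p.2)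
    univ_mem
  have hz : Tendsto (fun p : P × P => p.1 * p.2) G (𝓝 z) := hz
  have hx : Tendsto (fun p : P × P => p.1) G (𝓝 x₀) := (continuous_fst.tendsto _).mono_left hG
  have hy : Tendsto (fun p : P × P => p.2) G (𝓝 y₀) := (continuous_snd.tendsto _).mono_left hG
  suffices h : x₀⁻¹ * (z * y₀⁻¹) = 1 by
    have : z = x₀ * y₀ := by
      rw [← mul_assoc, mul_inv_eq_one, inv_mul_eq_iff_eq_mul] at h
      exact h
    rwa [this] at hz
  by_contra hg
  obtain ⟨W, hW, ⟨w, hw⟩, hsep⟩ := exists_isOpen_disjoint_quotients hright hcount hdense hleft hg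
  have h1 : Tendsto (fun p : P × P => w * (p.1⁻¹ * x₀)) G (𝓝 w) := by
    have := ((hlt w).tendsto _).comp (((hright x₀).tendsto _).comp ((hinv.tendsto _).comp hx))
    simpa [Function.comp_def] using this
  have h2 : Tendsto (fun p : P × P => w * (p.2 * y₀⁻¹)) G (𝓝 w) := by
    have := ((hlt w).tendsto _).comp (((hright y₀⁻¹).tendsto _).comp hy)
    simpa [Function.comp_def] using this
  have h3 : Tendsto (fun p : P × P => w * (x₀⁻¹ * (p.1 * p.2 * y₀⁻¹) * (x₀⁻¹ * (z * y₀⁻¹))⁻¹)) G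
      (𝓝 w) := by
    have := ((hlt w).tendsto _).comp (((hright (x₀⁻¹ * (z * y₀⁻¹))⁻¹).tendsto _).comp
      (((hlt x₀⁻¹).tendsto _).comp (((hright y₀⁻¹).tendsto _).comp hz)))
    simp only [Function.comp_def, mul_inv_cancel, mul_one] at this
    exact this
  have hWw := hW.mem_nhds hw
  obtain ⟨p, hp1, hp2, hp3⟩ := ((h1.eventually hWw).and
    ((h2.eventually hWw).and (h3.eventually hWw))).exists
  refine hsep (x₀⁻¹ * (p.1 * p.2 * y₀⁻¹)) _ hp1 ?_ w hw hp3
  have : w * (p.1⁻¹ * x₀) * (x₀⁻¹ * (p.1 * p.2 * y₀⁻¹)) = w * (p.2 * y₀⁻¹) := by group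
  rwa [this]

end Separable

theorem Submonoid.countable_closure {M : Type*} [Monoid M] {T : Set M} (hT : T.Countable) :
    (Submonoid.closure T : Set M).Countable := by
  have : Countable T := hT.to_subtype
  refine (countable_range fun l : List T => (l.map Subtype.val).prod).mono fun x hx => ?_
  obtain ⟨l, hl, rfl⟩ := Submonoid.exists_list_of_mem_closure hx
  exact ⟨l.pmap Subtype.mk hl, by simp [List.map_pmap]⟩

/-- In a compact Hausdorff right topological group, the closure of a submonoid of the topological
center is a subgroup. -/
theorem exists_subgroup_coe_eq_closure [CompactSpace P] [T2Space P]
    (hright : ∀ a : P, Continuous fun x : P => x * a) (H : Submonoid P)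
    (hleft : ∀ a ∈ H, Continuous fun x : P => a * x) :
    ∃ K : Subgroup P, (K : Set P) = closure (H : Set P) := by
  have hmul : ∀ a ∈ closure (H : Set P), ∀ b ∈ closure (H : Set P), a * b ∈ closure (H : Set P) := by
    intro a ha b hb
    have hHb : MapsTo (fun x => x * b) (H : Set P) (closure (H : Set P)) := fun h hh =>
      map_mem_closure (f := fun x => h * x) (hleft h hh) hb fun h' hh' => H.mul_mem hh hh'
    simpa using map_mem_closure (hright b) ha hHb
  refine ⟨{ carrier := closure (H : Set P)
            mul_mem' := fun {a b} ha hb => hmul a ha b hb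
            one_mem' := subset_closure H.one_mem
            inv_mem' := fun {a} ha => ?_ }, rfl⟩
  obtain ⟨m, ⟨b, hb, rfl⟩, hm⟩ := exists_idempotent_in_compact_subsemigroup hright
    ((fun x => x * a) '' closure (H : Set P)) ⟨_, a, ha, rfl⟩
    (isClosed_closure.isCompact.image (hright a)) (by
      rintro _ ⟨b, hb, rfl⟩ _ ⟨c, hc, rfl⟩
      exact ⟨b * a * c, hmul _ (hmul b hb a ha) c hc, by simp [mul_assoc]⟩)
  have : b * a = 1 := mul_eq_left.1 hm
  rwa [← eq_inv_of_mul_eq_one_left this]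

/-- Countable subsets of an admissible Fréchet–Urysohn compact right topological group lie in
closed subgroups that are topological groups. -/
theorem exists_isClosed_subgroup_of_countable [CompactSpace P] [T2Space P] [FrechetUrysohnSpace P]
    (hright : ∀ a : P, Continuous fun x : P => x * a)
    (hadm : Dense {a : P | Continuous fun x : P => a * x}) {S : Set P} (hS : S.Countable) :
    ∃ K : Subgroup P, S ⊆ K ∧ IsClosed (K : Set P) ∧ IsTopologicalGroup K := by
  choose u hu hlim using fun s : P => mem_closure_iff_seq_limit.1 (hadm s)
  let T : Set P := ⋃ s ∈ S, range (u s)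
  let H : Submonoid P := Submonoid.closure T
  have hH : ∀ a ∈ H, Continuous fun x : P => a * x := by
    intro a ha
    induction ha using Submonoid.closure_induction with
    | mem a ha =>
      obtain ⟨s, -, n, rfl⟩ := mem_iUnion₂.1 ha
      exact hu s n
    | one => simpa using continuous_id'
    | mul a b _ _ ha hb => simpa [mul_assoc, Function.comp_def] using ha.comp hb
  obtain ⟨K, hK⟩ := exists_subgroup_coe_eq_closure hright H hH
  have hKc : IsClosed (K : Set P) := hK ▸ isClosed_closure
  have : CompactSpace K := isCompact_iff_compactSpace.1 hKc.isCompact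
  have hrightK : ∀ a : K, Continuous fun x : K => x * a := fun a =>
    ((hright a.1).comp continuous_subtype_val).subtype_mk _
  have hcount : ((↑) ⁻¹' (H : Set P) : Set K).Countable :=
    (Submonoid.countable_closure (hS.biUnion fun s _ => countable_range _)).preimage
      Subtype.val_injective
  have hdense : Dense ((↑) ⁻¹' (H : Set P) : Set K) := by
    intro x
    have himage : ((↑) '' ((↑) ⁻¹' (H : Set P) : Set K) : Set P) = H := by
      refine image_preimage_eq_of_subset fun h hh => ?_
      exact ⟨⟨h, hK.symm.subset (subset_closure hh)⟩, rfl⟩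
    rw [closure_subtype, himage]
    exact hK.subset x.2
  have hleftK : ∀ a ∈ ((↑) ⁻¹' (H : Set P) : Set K), Continuous fun x : K => a * x :=
    fun a ha => ((hH a.1 ha).comp continuous_subtype_val).subtype_mk _
  have : FrechetUrysohnSpace K := Subtype.instFrechetUrysohnSpace
  refine ⟨K, fun s hs => ?_, hKc,
    { continuous_mul := continuous_mul_of_countable_dense hrightK hcount hdense hleftK
      continuous_inv := continuous_inv_of_countable_dense hrightK hcount hdense hleftK }⟩
  rw [hK]
  exact mem_closure_of_tendsto (hlim s) (Eventually.of_forall fun n =>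
    Submonoid.subset_closure (mem_biUnion hs ⟨n, rfl⟩))

theorem continuous_inv_of_frechetUrysohn [CompactSpace P] [T2Space P] [FrechetUrysohnSpace P]
    (hright : ∀ a : P, Continuous fun x : P => x * a)
    (hadm : Dense {a : P | Continuous fun x : P => a * x}) : Continuous fun x : P => x⁻¹ := by
  refine continuous_iff_seqContinuous.2 fun x x₀ hx => ?_
  obtain ⟨K, hSK, -, hK⟩ := exists_isClosed_subgroup_of_countable hright hadm
    ((countable_range x).insert x₀)
  let y : ℕ → K := fun n => ⟨x n, hSK (mem_insert_of_mem _ ⟨n, rfl⟩)⟩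
  let y₀ : K := ⟨x₀, hSK (mem_insert _ _)⟩
  have hy : Tendsto y atTop (𝓝 y₀) := tendsto_subtype_rng.2 hx
  exact tendsto_subtype_rng.1 hy.inv

theorem continuous_mul_of_frechetUrysohn [CompactSpace P] [T2Space P] [FrechetUrysohnSpace P]
    (hright : ∀ a : P, Continuous fun x : P => x * a)
    (hadm : Dense {a : P | Continuous fun x : P => a * x}) :
    Continuous fun p : P × P => p.1 * p.2 := by
  have hlt := continuous_const_mul_of_continuous_inv hright
    (continuous_inv_of_frechetUrysohn hright hadm)
  refine continuous_iff_continuousAt.2 fun ⟨x₀, y₀⟩ V hV => ?_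
  obtain ⟨V', hV'V, hV'o, hV'⟩ := mem_nhds_iff.1 hV
  obtain ⟨C, hC, hCc, hCV⟩ := exists_mem_nhds_isClosed_subset
    ((hlt x₀).continuousAt.preimage_mem_nhds (hV'o.mem_nhds hV'))
  let A : Set P := {x | ∃ y ∈ C, x * y ∉ V'}
  have hA : x₀ ∉ closure A := by
    intro hx₀
    obtain ⟨x, hxA, hx⟩ := mem_closure_iff_seq_limit.1 hx₀
    choose y hyC hxy using hxA
    obtain ⟨K, hSK, hKc, hK⟩ := exists_isClosed_subgroup_of_countable hright hadm
      (((countable_range x).union (countable_range y)).insert x₀)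
    let x' : ℕ → K := fun n => ⟨x n, hSK (.inr (.inl ⟨n, rfl⟩))⟩
    let y' : ℕ → K := fun n => ⟨y n, hSK (.inr (.inr ⟨n, rfl⟩))⟩
    let x₀' : K := ⟨x₀, hSK (mem_insert _ _)⟩
    have : CompactSpace K := isCompact_iff_compactSpace.1 hKc.isCompact
    let G : Ultrafilter ℕ := Ultrafilter.of atTop
    have hx' : Tendsto x' G (𝓝 x₀') := (tendsto_subtype_rng.2 hx).mono_left (Ultrafilter.of_le _)
    obtain ⟨z, -, hz⟩ := isCompact_univ.ultrafilter_le_nhds' (G.map y') univ_mem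
    have hz : Tendsto y' G (𝓝 z) := hz
    have hzC : z.1 ∈ C := hCc.mem_of_tendsto (tendsto_subtype_rng.1 hz) (Eventually.of_forall hyC)
    have hxz : x₀ * z.1 ∈ V'ᶜ := hV'o.isClosed_compl.mem_of_tendsto
      (tendsto_subtype_rng.1 (hx'.mul hz)) (Eventually.of_forall hxy)
    exact hxz (hCV hzC)
  have hnhds : (closure A)ᶜ ×ˢ C ∈ 𝓝 (x₀, y₀) :=
    prod_mem_nhds (isClosed_closure.isOpen_compl.mem_nhds hA) hC
  refine mem_map.2 (mem_of_superset hnhds fun p hp => ?_)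
  by_contra h
  exact hp.1 (subset_closure ⟨p.2, hp.2, fun hp' => h (hV'V hp')⟩)

end RightTopologicalGroup

/-- a compact Hausdorff right topological admissible group which is a
Fréchet–Urysohn space is a topological group. -/
theorem stmt12 {P : Type*} [Group P] [TopologicalSpace P] [CompactSpace P] [T2Space P]
    (hright : ∀ a : P, Continuous fun x : P => x * a)
    (hadm : Dense {a : P | Continuous fun x : P => a * x})
    (hFU : FrechetUrysohnSpace P) :
    Continuous (fun p : P × P => p.1 * p.2) ∧ Continuous (fun p : P => p⁻¹) :=
  ⟨continuous_mul_of_frechetUrysohn hright hadm, continuous_inv_of_frechetUrysohn hright hadm⟩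
end

section
/- Let V be a real Banach space containing no isomorphic copy of ℓ¹. Let M be a set of continuous linear operators T : V → V with ‖T‖ ≤ 1 which contains the identity and is closed under composition. Let Y ⊆ V* be a weak*-compact set with T*(Y) ⊆ Y for every T ∈ M, and let Q be the weak*-closed convex hull of Y in V* (so Q is weak*-compact and T*(Q) ⊆ Q for every T ∈ M). Then any two elements p, q of the closure of {T*|_Q : T ∈ M} in the compact product space Q^Q (topology of pointwise convergence, Q carrying the weak* topology) that agree on Y are equal; i.e., the restriction homomorphism from the enveloping semigroup of Q to the enveloping semigroup of Y is injective. -/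
/-- `V` contains an isomorphic copy of `ℓ¹ = ℓ¹(ℕ, ℝ)`. -/
def ContainsL1Copy (V : Type*) [NormedAddCommGroup V] [NormedSpace ℝ V] : Prop :=
  ∃ f : lp (fun _ : ℕ => ℝ) 1 →L[ℝ] V, ∃ c : ℝ, 0 < c ∧ ∀ x, c * ‖x‖ ≤ ‖f x‖

section

open Set Filter Topology MeasureTheory

/-- If every finite family of good sets can be split simultaneously by some pair
`H true i`, `H false i`, then there is an independent sequence of such pairs. -/
lemma exists_seq_forall_inter_good {X ι : Type*} (good : Set X → Prop) (H : Bool → ι → Set X)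
    (h0 : good univ)
    (h : ∀ 𝒰 : Set (Set X), 𝒰.Finite → (∀ U ∈ 𝒰, good U) →
      ∃ i, ∀ U ∈ 𝒰, ∀ b, good (U ∩ H b i)) :
    ∃ u : ℕ → ι, ∀ (n : ℕ) (s : ℕ → Bool), good {x | ∀ k < n, x ∈ H (s k) (u k)} := by
  choose φ hφ using fun 𝒰 : {𝒰 : Set (Set X) // 𝒰.Finite ∧ ∀ U ∈ 𝒰, good U} =>
    h 𝒰.1 𝒰.2.1 𝒰.2.2
  let step : {𝒰 : Set (Set X) // 𝒰.Finite ∧ ∀ U ∈ 𝒰, good U} →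
      {𝒰 : Set (Set X) // 𝒰.Finite ∧ ∀ U ∈ 𝒰, good U} := fun 𝒰 =>
    ⟨image2 (fun U b => U ∩ H b (φ 𝒰)) 𝒰.1 univ, 𝒰.2.1.image2 _ finite_univ, by
      rintro _ ⟨U, hU, b, -, rfl⟩
      exact hφ 𝒰 U hU b⟩
  let F : ℕ → {𝒰 : Set (Set X) // 𝒰.Finite ∧ ∀ U ∈ 𝒰, good U} := fun n =>
    step^[n] ⟨{univ}, finite_singleton _, by simpa using h0⟩
  have hF : ∀ n, F (n + 1) = step (F n) := fun n => Function.iterate_succ_apply' step n _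
  have key : ∀ (n : ℕ) (s : ℕ → Bool), {x | ∀ k < n, x ∈ H (s k) (φ (F k))} ∈ (F n).1 := by
    intro n s
    induction n with
    | zero => simp [F]
    | succ n ih =>
      rw [hF]
      refine ⟨_, ih, s n, mem_univ _, ?_⟩
      ext x
      simp only [mem_inter_iff, mem_ofPred_eq, Nat.lt_succ_iff_lt_or_eq]
      grind
  exact ⟨fun n => φ (F n), fun n s => (F n).2.2 _ (key n s)⟩

/-- Bounded sequences in `L²` accumulate weakly: along an ultrafilter, the integrals over
measurable sets of a bounded family of continuous functions converge to those of some
`g ∈ L²`. -/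
lemma exists_tendsto_setIntegral {X ι : Type*} [TopologicalSpace X] [CompactSpace X]
    [MeasurableSpace X] [BorelSpace X] (μ : Measure X) [IsFiniteMeasure μ]
    (f : ι → C(X, ℝ)) (C : ℝ) (hC : ∀ i, ‖f i‖ ≤ C) (l : Ultrafilter ι) :
    ∃ g : Lp ℝ 2 μ, ∀ s, MeasurableSet s →
      Tendsto (fun i => ∫ x in s, f i x ∂μ) l (𝓝 (∫ x in s, g x ∂μ)) := by
  let P : C(X, ℝ) →L[ℝ] Lp ℝ 2 μ := ContinuousMap.toLp 2 μ ℝ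
  let D : ι → WeakDual ℝ (Lp ℝ 2 μ) := fun i =>
    StrongDual.toWeakDual (InnerProductSpace.toDual ℝ (Lp ℝ 2 μ) (P (f i)))
  have hD : ∀ i, D i ∈ WeakDual.toStrongDual ⁻¹'
      Metric.closedBall (0 : StrongDual ℝ (Lp ℝ 2 μ)) (‖P‖ * C) := by
    intro i
    rw [mem_preimage, mem_closedBall_zero_iff]
    change ‖InnerProductSpace.toDual ℝ (Lp ℝ 2 μ) (P (f i))‖ ≤ _
    rw [LinearIsometryEquiv.norm_map]
    exact (P.le_opNorm _).trans (by gcongr; exact hC i)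
  obtain ⟨φ, -, hφ⟩ := isCompact_iff_ultrafilter_le_nhds.1
    (WeakDual.isCompact_closedBall (𝕜 := ℝ) (0 : StrongDual ℝ (Lp ℝ 2 μ)) (‖P‖ * C))
    (l.map D) (by
      rw [le_principal_iff]
      exact Filter.mem_map.2 (Filter.univ_mem' hD))
  refine ⟨(InnerProductSpace.toDual ℝ (Lp ℝ 2 μ)).symm (WeakDual.toStrongDual φ), fun s hs => ?_⟩
  have h1 : Tendsto (fun i => D i (indicatorConstLp 2 hs (measure_ne_top μ s) (1 : ℝ))) l
      (𝓝 (φ (indicatorConstLp 2 hs (measure_ne_top μ s) (1 : ℝ)))) :=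
    ((WeakDual.eval_continuous _).tendsto φ).comp hφ
  have h2 : φ (indicatorConstLp 2 hs (measure_ne_top μ s) (1 : ℝ)) =
      ∫ x in s, (InnerProductSpace.toDual ℝ (Lp ℝ 2 μ)).symm (WeakDual.toStrongDual φ) x ∂μ := by
    rw [← L2.inner_indicatorConstLp_one (𝕜 := ℝ) hs (measure_ne_top μ s), real_inner_comm,
      InnerProductSpace.toDual_symm_apply]
    rfl
  rw [← h2]
  refine h1.congr fun i => ?_
  change inner ℝ (P (f i)) _ = _
  rw [real_inner_comm, L2.inner_indicatorConstLp_one]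
  refine integral_congr_ae (ae_restrict_of_ae ?_)
  exact ContinuousMap.coeFn_toLp μ (f i)

/-- A bounded family of continuous functions which converges pointwise to `0` but whose
integrals converge to a positive number contains an independent sequence. -/
lemma exists_independent_seq {X ι : Type*} [TopologicalSpace X] [CompactSpace X] [T2Space X]
    [MeasurableSpace X] [BorelSpace X] (μ : Measure X) [IsFiniteMeasure μ] [μ.Regular]
    (f : ι → C(X, ℝ)) (C : ℝ) (hC : ∀ i, ‖f i‖ ≤ C) (l : Ultrafilter ι)
    (hf : ∀ x, Tendsto (fun i => f i x) l (𝓝 0)) {c : ℝ} (hc : 0 < c)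
    (hint : Tendsto (fun i => ∫ x, f i x ∂μ) l (𝓝 c)) :
    ∃ a b : ℝ, b < a ∧ ∃ u : ℕ → ι, ∀ (n : ℕ) (s : ℕ → Bool), ∃ x, ∀ k < n,
      bif s k then a < f (u k) x else f (u k) x < b := by
  obtain ⟨g, hg⟩ := exists_tendsto_setIntegral μ f C hC l
  have hgm : Measurable g := (Lp.stronglyMeasurable g).measurable
  have hgi : Integrable g μ := (Lp.memLp g).integrable (by norm_num)
  have hgc : ∫ x, g x ∂μ = c := by
    have := hg univ MeasurableSet.univ
    simp only [Measure.restrict_univ] at this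
    exact tendsto_nhds_unique this hint
  obtain ⟨δ, hδ, hδc⟩ : ∃ δ : ℝ, 0 < δ ∧ δ * μ.real univ < c := by
    refine ⟨c / (2 * (μ.real univ + 1)), by positivity, ?_⟩
    have : 0 ≤ μ.real univ := measureReal_nonneg
    rw [div_mul_eq_mul_div, div_lt_iff₀ (by positivity)]
    nlinarith
  set E : Set X := {x | δ < g x} with hE
  have hEm : MeasurableSet E := measurableSet_lt measurable_const hgm
  have hEpos : 0 < μ E := by
    rw [pos_iff_ne_zero]
    intro h
    have h1 : g ≤ᵐ[μ] fun _ => δ := by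
      rw [EventuallyLE, ae_iff]
      simpa [hE] using h
    have h2 := integral_mono_ae hgi (integrable_const δ) h1
    rw [integral_const, hgc, smul_eq_mul] at h2
    linarith
  let H : Bool → ι → Set X := fun b i => bif b then {x | δ / 2 < f i x} else {x | f i x < δ / 4}
  have hHo : ∀ b i, IsOpen (H b i) := by
    rintro (_ | _) i
    · exact isOpen_lt (f i).continuous continuous_const
    · exact isOpen_lt continuous_const (f i).continuous
  have htrue : ∀ U, IsOpen U → 0 < μ (U ∩ E) → ∀ᶠ i in l, 0 < μ ((U ∩ H true i) ∩ E) := by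
    intro U hU hpos
    have hm : MeasurableSet (U ∩ E) := hU.measurableSet.inter hEm
    have hr : 0 < μ.real (U ∩ E) := by
      rw [measureReal_def]; exact ENNReal.toReal_pos hpos.ne' (measure_ne_top _ _)
    have h1 : δ * μ.real (U ∩ E) ≤ ∫ x in U ∩ E, g x ∂μ := by
      have := setIntegral_mono_on (integrable_const δ).integrableOn hgi.integrableOn hm
        (fun x hx => (le_of_lt hx.2 : δ ≤ g x)) (μ := μ)
      simpa [mul_comm] using this
    have h2 : δ / 2 * μ.real (U ∩ E) < ∫ x in U ∩ E, g x ∂μ := by nlinarith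
    filter_upwards [(hg _ hm).eventually (lt_mem_nhds h2)] with i hi
    rw [pos_iff_ne_zero]
    intro h0
    have h3 : ∀ᵐ x ∂(μ.restrict (U ∩ E)), f i x ≤ δ / 2 := by
      rw [ae_restrict_iff' hm, ae_iff]
      convert h0 using 2
      ext x
      simp only [H, mem_ofPred_eq, mem_inter_iff, cond_true, Classical.not_imp, not_le]
      tauto
    have h4 := integral_mono_ae
      ((f i).continuous.integrable_of_hasCompactSupport
        (HasCompactSupport.of_compactSpace _)).integrableOn
      (integrable_const (δ / 2)) h3
    simp only [integral_const, measureReal_restrict_apply_univ, smul_eq_mul] at h4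
    linarith
  have hfalse : ∀ U, IsOpen U → 0 < μ (U ∩ E) → ∀ᶠ i in l, 0 < μ ((U ∩ H false i) ∩ E) := by
    intro U hU hpos
    have hm : MeasurableSet (U ∩ E) := hU.measurableSet.inter hEm
    obtain ⟨K, hKU, hK, hKpos⟩ := hm.exists_lt_isCompact_of_ne_top (measure_ne_top μ _) hpos
    obtain ⟨x, hxK, hx⟩ : ∃ x ∈ K, ∀ t ∈ 𝓝[K] x, μ t ≠ 0 := by
      by_contra! hcon
      exact hKpos.ne' (hK.measure_zero_of_nhdsWithin hcon)
    filter_upwards [(hf x).eventually (gt_mem_nhds (show (0 : ℝ) < δ / 4 by positivity))]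
      with i hi
    have hnhds : (U ∩ H false i) ∩ K ∈ 𝓝[K] x :=
      inter_mem (mem_nhdsWithin_of_mem_nhds
        ((hU.inter (hHo _ _)).mem_nhds ⟨(hKU hxK).1, hi⟩)) self_mem_nhdsWithin
    exact (pos_iff_ne_zero.2 (hx _ hnhds)).trans_le
      (measure_mono (inter_subset_inter_right _ fun y hy => (hKU hy).2))
  obtain ⟨u, hu⟩ := exists_seq_forall_inter_good (fun U => IsOpen U ∧ 0 < μ (U ∩ E)) H
    ⟨isOpen_univ, by simpa using hEpos⟩ (by
      intro 𝒰 hfin h𝒰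
      have h1 : ∀ᶠ i in (l : Filter ι), ∀ U ∈ 𝒰, ∀ b, 0 < μ ((U ∩ H b i) ∩ E) := by
        rw [eventually_all_finite hfin]
        intro U hU
        filter_upwards [htrue U (h𝒰 U hU).1 (h𝒰 U hU).2, hfalse U (h𝒰 U hU).1 (h𝒰 U hU).2]
          with i hi hi'
        rintro (_ | _)
        exacts [hi', hi]
      obtain ⟨i, hi⟩ := h1.exists
      exact ⟨i, fun U hU b => ⟨(h𝒰 U hU).1.inter (hHo b i), hi U hU b⟩⟩)
  refine ⟨δ / 2, δ / 4, by linarith, u, fun n s => ?_⟩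
  obtain ⟨x, hx⟩ := nonempty_of_measure_ne_zero (hu n s).2.ne'
  refine ⟨x, fun k hk => ?_⟩
  have := hx.1 k hk
  cases hs : s k <;> simpa [H, hs] using this

/-- Every point of the weak*-closed convex hull of a weak*-compact set `Y` is the barycentre
of a regular finite measure on `Y`. -/
lemma exists_measure_of_mem_closure_convexHull {V : Type*} [NormedAddCommGroup V]
    [NormedSpace ℝ V] (Y : Set (WeakDual ℝ V)) [CompactSpace Y] [MeasurableSpace Y]
    [BorelSpace Y] {φ : WeakDual ℝ V} (hφ : φ ∈ closure (convexHull ℝ Y)) :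
    ∃ μ : Measure Y, μ.Regular ∧ IsFiniteMeasure μ ∧
      ∀ v : V, φ v = ∫ ψ : Y, (ψ : WeakDual ℝ V) v ∂μ := by
  have hcont : ∀ v : V, Continuous fun ψ : Y => (ψ : WeakDual ℝ V) v := fun v =>
    (WeakDual.eval_continuous v).comp continuous_subtype_val
  have hint : ∀ (v : V) (μ : Measure Y) [IsFiniteMeasure μ],
      Integrable (fun ψ : Y => (ψ : WeakDual ℝ V) v) μ := fun v μ _ =>
    (hcont v).integrable_of_hasCompactSupport (HasCompactSupport.of_compactSpace _)
  let B : Set (WeakDual ℝ V) := {φ | ∃ μ : ProbabilityMeasure Y,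
    ∀ v : V, φ v = ∫ ψ : Y, (ψ : WeakDual ℝ V) v ∂(μ : Measure Y)}
  have hYB : Y ⊆ B := by
    intro ψ hψ
    refine ⟨⟨Measure.dirac ⟨ψ, hψ⟩, inferInstance⟩, fun v => ?_⟩
    simp
  have hBconv : Convex ℝ B := by
    rintro φ₁ ⟨μ, hμ⟩ φ₂ ⟨ν, hν⟩ a b ha hb hab
    have hprob : IsProbabilityMeasure (ENNReal.ofReal a • (μ : Measure Y) +
        ENNReal.ofReal b • (ν : Measure Y)) := by
      constructor
      simp [← ENNReal.ofReal_add ha hb, hab]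
    refine ⟨⟨_, hprob⟩, fun v => ?_⟩
    have h1 := (hint v (μ : Measure Y)).smul_measure (ENNReal.ofReal_ne_top (r := a))
    have h2 := (hint v (ν : Measure Y)).smul_measure (ENNReal.ofReal_ne_top (r := b))
    change a * φ₁ v + b * φ₂ v = _
    rw [ProbabilityMeasure.coe_mk, integral_add_measure h1 h2, integral_smul_measure,
      integral_smul_measure, ENNReal.toReal_ofReal ha, ENNReal.toReal_ofReal hb, ← hμ, ← hν]
    rfl
  have hBclosed : IsClosed B := by
    have hcl : IsClosed {x : WeakDual ℝ V × ProbabilityMeasure Y |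
        ∀ v : V, x.1 v = ∫ ψ : Y, (ψ : WeakDual ℝ V) v ∂(x.2 : Measure Y)} := by
      rw [ofPred_forall]
      refine isClosed_iInter fun v =>
        isClosed_eq ((WeakDual.eval_continuous v).comp continuous_fst) ?_
      exact (ProbabilityMeasure.continuous_integral_boundedContinuousFunction
        (BoundedContinuousFunction.mkOfCompact ⟨_, hcont v⟩)).comp continuous_snd
    convert isClosedMap_fst_of_compactSpace _ hcl
    ext φ
    simp [B]
  obtain ⟨μ, hμ⟩ := closure_minimal (convexHull_min hYB hBconv) hBclosed hφ
  obtain ⟨ν, hν, hνf, h⟩ := Measure.exists_regular_eq_of_compactSpace (μ : Measure Y)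
  exact ⟨ν, hν, hνf, fun v => (hμ v).trans
    (h (BoundedContinuousFunction.mkOfCompact ⟨_, hcont v⟩))⟩

/-- A bounded sequence satisfying a lower `ℓ¹`-estimate spans a copy of `ℓ¹`. -/
lemma containsL1Copy_of_lower_estimate {V : Type*} [NormedAddCommGroup V] [NormedSpace ℝ V]
    [CompleteSpace V] (w : ℕ → V) (C : ℝ) (hw : ∀ k, ‖w k‖ ≤ C) {c : ℝ} (hc : 0 < c)
    (h : ∀ (n : ℕ) (t : ℕ → ℝ),
      c * ∑ k ∈ Finset.range n, |t k| ≤ ‖∑ k ∈ Finset.range n, t k • w k‖) :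
    ContainsL1Copy V := by
  have hn : ∀ x : lp (fun _ : ℕ => ℝ) 1, HasSum (fun k => |x k|) ‖x‖ := fun x => by
    simpa using lp.hasSum_norm (by simp) x
  have hle : ∀ (x : lp (fun _ : ℕ => ℝ) 1) k, ‖x k • w k‖ ≤ C * |x k| := fun x k => by
    rw [norm_smul, Real.norm_eq_abs, mul_comm]
    gcongr
    exact hw k
  have hs : ∀ x : lp (fun _ : ℕ => ℝ) 1, Summable fun k => x k • w k := fun x =>
    Summable.of_norm_bounded ((hn x).summable.mul_left C) (hle x)
  let f : lp (fun _ : ℕ => ℝ) 1 →ₗ[ℝ] V :=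
    { toFun := fun x => ∑' k, x k • w k
      map_add' := fun x y => by
        simp only [lp.coeFn_add, Pi.add_apply, add_smul]
        exact (hs x).tsum_add (hs y)
      map_smul' := fun r x => by
        simp only [lp.coeFn_smul, Pi.smul_apply, smul_assoc, RingHom.id_apply]
        exact (hs x).tsum_const_smul r }
  refine ⟨f.mkContinuous C fun x => tsum_of_norm_bounded ((hn x).mul_left C) (hle x),
    c, hc, fun x => ?_⟩
  exact le_of_tendsto_of_tendsto' ((hn x).tendsto_sum_nat.const_mul c)
    (hs x).hasSum.tendsto_sum_nat.norm fun n => h n x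

/-- A bounded sequence of vectors which is independent on a bounded set of functionals
satisfies a lower `ℓ¹`-estimate. -/
lemma lower_estimate_of_independent {V : Type*} [NormedAddCommGroup V] [NormedSpace ℝ V]
    (Y : Set (StrongDual ℝ V)) {R : ℝ} (hR : 0 < R) (hY : ∀ ψ ∈ Y, ‖ψ‖ ≤ R) (w : ℕ → V)
    {a b : ℝ} (h : ∀ (n : ℕ) (s : ℕ → Bool), ∃ ψ ∈ Y, ∀ k < n,
      bif s k then a < ψ (w k) else ψ (w k) < b) (n : ℕ) (t : ℕ → ℝ) :
    (a - b) / (2 * R) * ∑ k ∈ Finset.range n, |t k| ≤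
      ‖∑ k ∈ Finset.range n, t k • w k‖ := by
  obtain ⟨ψ, hψY, hψ⟩ := h n fun k => decide (0 ≤ t k)
  obtain ⟨χ, hχY, hχ⟩ := h n fun k => decide (¬ 0 ≤ t k)
  have hterm : ∀ k ∈ Finset.range n, |t k| * (a - b) ≤ t k * ((ψ - χ) (w k)) := by
    intro k hk
    have h1 := hψ k (Finset.mem_range.1 hk)
    have h2 := hχ k (Finset.mem_range.1 hk)
    rw [sub_apply]
    by_cases ht : 0 ≤ t k
    · simp only [ht, decide_true, cond_true, not_true, decide_false, cond_false] at h1 h2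
      rw [abs_of_nonneg ht]
      exact mul_le_mul_of_nonneg_left (by linarith) ht
    · simp only [ht, decide_true, cond_true, not_false_eq_true, decide_false, cond_false] at h1 h2
      rw [abs_of_neg (not_le.1 ht)]
      nlinarith
  have h1 : (∑ k ∈ Finset.range n, |t k|) * (a - b) ≤
      (ψ - χ) (∑ k ∈ Finset.range n, t k • w k) := by
    rw [map_sum, Finset.sum_mul]
    simpa using Finset.sum_le_sum hterm
  have h2 : (ψ - χ) (∑ k ∈ Finset.range n, t k • w k) ≤
      2 * R * ‖∑ k ∈ Finset.range n, t k • w k‖ := by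
    refine (le_abs_self _).trans (((ψ - χ).le_opNorm _).trans ?_)
    gcongr
    linarith [norm_sub_le ψ χ, hY ψ hψY, hY χ hχY]
  rw [div_mul_eq_mul_div, div_le_iff₀ (by positivity)]
  linarith

/-- In a Banach space without a copy of `ℓ¹`, a bounded net which tends to `0` on a
weak*-compact set `Y` cannot have a positive limit at a point of the weak*-closed convex
hull of `Y`. -/
lemma not_pos_of_tendsto_zero {V ι : Type*} [NormedAddCommGroup V] [NormedSpace ℝ V]
    [CompleteSpace V] (hV : ¬ ContainsL1Copy V) (Y : Set (WeakDual ℝ V)) (hYcomp : IsCompact Y)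
    (w : ι → V) (C : ℝ) (hw : ∀ i, ‖w i‖ ≤ C) (l : Filter ι) [l.NeBot]
    (hl : ∀ ψ ∈ Y, Tendsto (fun i => ψ (w i)) l (𝓝 0)) {φ : WeakDual ℝ V}
    (hφ : φ ∈ closure (convexHull ℝ Y)) {c : ℝ} (hc : Tendsto (fun i => φ (w i)) l (𝓝 c)) :
    ¬ 0 < c := by
  intro hpos
  obtain ⟨R, hR, hYR⟩ : ∃ R > 0, ∀ ψ ∈ Y, ‖WeakDual.toStrongDual ψ‖ ≤ R := by
    obtain ⟨C', hC'⟩ := banach_steinhaus (g := fun ψ : Y => WeakDual.toStrongDual (ψ : WeakDual ℝ V))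
      fun v => by
        obtain ⟨C', hC'⟩ := hYcomp.exists_bound_of_continuousOn
          (WeakDual.eval_continuous (𝕜 := ℝ) v).continuousOn
        exact ⟨C', fun ψ => hC' ψ ψ.2⟩
    exact ⟨max C' 1, by positivity, fun ψ hψ => (hC' ⟨ψ, hψ⟩).trans (le_max_left _ _)⟩
  have : CompactSpace Y := isCompact_iff_compactSpace.1 hYcomp
  let : MeasurableSpace Y := borel Y
  have : BorelSpace Y := ⟨rfl⟩
  obtain ⟨μ, hμ, hμf, hμφ⟩ := exists_measure_of_mem_closure_convexHull Y hφ
  let f : ι → C(Y, ℝ) := fun i => ⟨fun ψ => (ψ : WeakDual ℝ V) (w i),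
    (WeakDual.eval_continuous (w i)).comp continuous_subtype_val⟩
  have hf : ∀ i, ‖f i‖ ≤ R * |C| := fun i => by
    rw [ContinuousMap.norm_le _ (by positivity)]
    intro ψ
    refine ((WeakDual.toStrongDual (ψ : WeakDual ℝ V)).le_opNorm (w i)).trans ?_
    gcongr
    exacts [hYR ψ ψ.2, (hw i).trans (le_abs_self C)]
  obtain ⟨a, b, hab, u, hu⟩ := exists_independent_seq μ f _ hf (Ultrafilter.of l)
    (fun ψ => (hl ψ ψ.2).mono_left (Ultrafilter.of_le l)) hpos
    (by
      simp only [hμφ] at hc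
      exact hc.mono_left (Ultrafilter.of_le l))
  refine hV (containsL1Copy_of_lower_estimate (fun k => w (u k)) C (fun k => hw _)
    (c := (a - b) / (2 * R)) (div_pos (sub_pos.2 hab) (by positivity))
    (lower_estimate_of_independent (WeakDual.toStrongDual '' Y) hR ?_ _ ?_))
  · rintro _ ⟨ψ, hψ, rfl⟩
    exact hYR ψ hψ
  · intro n s
    obtain ⟨ψ, hψ⟩ := hu n s
    exact ⟨_, ⟨ψ, ψ.2, rfl⟩, hψ⟩

/-- Two elements of the enveloping semigroup of the weak*-closed convex hull of `Y` which
agree on `Y` satisfy `p φ v ≤ q φ v` everywhere. -/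
lemma apply_le_of_agree_on {V : Type*} [NormedAddCommGroup V] [NormedSpace ℝ V]
    [CompleteSpace V] (hV : ¬ ContainsL1Copy V) (M : Set (V →L[ℝ] V)) (hM1 : ∀ T ∈ M, ‖T‖ ≤ 1)
    (Y : Set (WeakDual ℝ V)) (hYcomp : IsCompact Y)
    (p q : closure (convexHull ℝ Y) → closure (convexHull ℝ Y))
    (hp : p ∈ closure {g : closure (convexHull ℝ Y) → closure (convexHull ℝ Y) |
      ∃ T ∈ M, ∀ (ψ : closure (convexHull ℝ Y)) (v : V),
        (g ψ : WeakDual ℝ V) v = (ψ : WeakDual ℝ V) (T v)})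
    (hq : q ∈ closure {g : closure (convexHull ℝ Y) → closure (convexHull ℝ Y) |
      ∃ T ∈ M, ∀ (ψ : closure (convexHull ℝ Y)) (v : V),
        (g ψ : WeakDual ℝ V) v = (ψ : WeakDual ℝ V) (T v)})
    (hagree : ∀ ψ : closure (convexHull ℝ Y), (ψ : WeakDual ℝ V) ∈ Y → p ψ = q ψ)
    (φ : closure (convexHull ℝ Y)) (v : V) :
    (p φ : WeakDual ℝ V) v ≤ (q φ : WeakDual ℝ V) v := by
  set S := {g : closure (convexHull ℝ Y) → closure (convexHull ℝ Y) |
      ∃ T ∈ M, ∀ (ψ : closure (convexHull ℝ Y)) (v : V),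
        (g ψ : WeakDual ℝ V) v = (ψ : WeakDual ℝ V) (T v)} with hS
  choose T hTM hT using fun g : S => g.2
  have hlp : (comap ((↑) : S → _) (𝓝 p)).NeBot := mem_closure_iff_comap_neBot.1 hp
  have hlq : (comap ((↑) : S → _) (𝓝 q)).NeBot := mem_closure_iff_comap_neBot.1 hq
  have hlim : ∀ (r : closure (convexHull ℝ Y) → closure (convexHull ℝ Y))
      (ψ : closure (convexHull ℝ Y)),
      Tendsto (fun g : S => (ψ : WeakDual ℝ V) (T g v)) (comap ((↑) : S → _) (𝓝 r))
        (𝓝 ((r ψ : WeakDual ℝ V) v)) := by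
    intro r ψ
    have hc : Continuous fun g : closure (convexHull ℝ Y) → closure (convexHull ℝ Y) =>
        (g ψ : WeakDual ℝ V) v :=
      (WeakDual.eval_continuous v).comp (continuous_subtype_val.comp (continuous_apply ψ))
    exact ((hc.tendsto r).comp tendsto_comap).congr fun g => hT g ψ v
  have hlim2 : ∀ ψ : closure (convexHull ℝ Y),
      Tendsto (fun g : S × S => (ψ : WeakDual ℝ V) (T g.1 v - T g.2 v))
        (comap ((↑) : S → _) (𝓝 p) ×ˢ comap ((↑) : S → _) (𝓝 q))
        (𝓝 ((p ψ : WeakDual ℝ V) v - (q ψ : WeakDual ℝ V) v)) := by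
    intro ψ
    simp only [map_sub]
    exact ((hlim p ψ).comp tendsto_fst).sub ((hlim q ψ).comp tendsto_snd)
  have hbound : ∀ g : S, ‖T g v‖ ≤ ‖v‖ := fun g =>
    (T g).le_of_opNorm_le (hM1 _ (hTM g)) v |>.trans_eq (one_mul _)
  have := not_pos_of_tendsto_zero hV Y hYcomp (fun g : S × S => T g.1 v - T g.2 v)
    (‖v‖ + ‖v‖) (fun g => (norm_sub_le _ _).trans (add_le_add (hbound _) (hbound _)))
    (comap ((↑) : S → _) (𝓝 p) ×ˢ comap ((↑) : S → _) (𝓝 q))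
    (fun ψ hψ => by
      have hψ' := subset_closure (subset_convexHull ℝ Y hψ)
      have := hlim2 ⟨ψ, hψ'⟩
      rwa [hagree ⟨ψ, hψ'⟩ hψ, sub_self] at this) φ.2 (hlim2 φ)
  linarith

end

/-- let `V` be a Banach space with no copy of `ℓ¹`, `M` a monoid of
contractions of `V`, `Y ⊆ V*` weak*-compact and invariant under the adjoints of members
of `M`, and `Q` the weak*-closed convex hull of `Y`.  Any two elements of the enveloping
semigroup of `Q` (the pointwise closure in `Q^Q` of the maps induced by adjoints of
members of `M`) that agree on `Y` are equal. -/
theorem stmt15 {V : Type*} [NormedAddCommGroup V] [NormedSpace ℝ V] [CompleteSpace V]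
    (hV : ¬ ContainsL1Copy V)
    (M : Set (V →L[ℝ] V))
    (hM1 : ∀ T ∈ M, ‖T‖ ≤ 1)
    (hMid : ContinuousLinearMap.id ℝ V ∈ M)
    (hMcomp : ∀ T ∈ M, ∀ U ∈ M, T.comp U ∈ M)
    (Y : Set (WeakDual ℝ V)) (hYcomp : IsCompact Y)
    (hYinv : ∀ T ∈ M, ∀ ψ ∈ Y, ∀ φ : WeakDual ℝ V, (∀ v : V, φ v = ψ (T v)) → φ ∈ Y)
    (p q : closure (convexHull ℝ Y) → closure (convexHull ℝ Y))
    (hp : p ∈ closure {g : closure (convexHull ℝ Y) → closure (convexHull ℝ Y) |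
      ∃ T ∈ M, ∀ (ψ : closure (convexHull ℝ Y)) (v : V),
        (g ψ : WeakDual ℝ V) v = (ψ : WeakDual ℝ V) (T v)})
    (hq : q ∈ closure {g : closure (convexHull ℝ Y) → closure (convexHull ℝ Y) |
      ∃ T ∈ M, ∀ (ψ : closure (convexHull ℝ Y)) (v : V),
        (g ψ : WeakDual ℝ V) v = (ψ : WeakDual ℝ V) (T v)})
    (hagree : ∀ ψ : closure (convexHull ℝ Y), (ψ : WeakDual ℝ V) ∈ Y → p ψ = q ψ) :
    p = q := by
  funext φ
  apply Subtype.ext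
  apply DFunLike.ext
  intro v
  exact le_antisymm (apply_le_of_agree_on hV M hM1 Y hYcomp p q hp hq hagree φ v)
    (apply_le_of_agree_on hV M hM1 Y hYcomp q p hq hp (fun ψ hψ => (hagree ψ hψ).symm) φ v)
end

section
/- Let S be a monoid acting on a compact metrizable space X such that every translation λ_s : X → X, x ↦ s·x, is continuous. Then the enveloping semigroup E(X) is metrizable if and only if the family of translations {λ_s : s ∈ S} is a fragmented family of self-maps of X (i.e., the system is hereditarily non-sensitive). Moreover, for X compact Hausdorff (not necessarily metrizable), metrizability of E(X) implies that {λ_s : s ∈ S} is a fragmented family. -/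
/-- The enveloping semigroup of an action of `S` on `X`: the pointwise closure of the set
of translations `x ↦ s • x` in the product space `X^X`. -/
def envSet (S X : Type*) [SMul S X] [TopologicalSpace X] : Set (X → X) :=
  closure {f : X → X | ∃ s : S, f = fun x => s • x}

/-- A family `F` of maps from a topological space `X` to a (compact Hausdorff) space `Y` is
fragmented if for every nonempty `A ⊆ X` and every entourage `ε` (a neighborhood of the
diagonal of `Y`, i.e. a member of the unique compatible uniformity of the compact
Hausdorff space `Y`) there is an open `O` meeting `A` such that `f (O ∩ A)` is `ε`-small
simultaneously for all `f ∈ F`. -/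
def IsFragmentedFamily {X Y : Type*} [TopologicalSpace X] [TopologicalSpace Y]
    (F : Set (X → Y)) : Prop :=
  ∀ A : Set X, A.Nonempty → ∀ ε ∈ nhdsSet (Set.diagonal Y),
    ∃ O : Set X, IsOpen O ∧ (O ∩ A).Nonempty ∧
      ∀ f ∈ F, ∀ a ∈ O ∩ A, ∀ b ∈ O ∩ A, (f a, f b) ∈ ε

open Set Topology Uniformity SetRel in
/-- A family of continuous maps between compact Hausdorff spaces whose pointwise closure is second
countable is fragmented. -/
theorem isFragmentedFamily_of_secondCountable_closure {X Y : Type*} [TopologicalSpace X]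
    [CompactSpace X] [T2Space X] [TopologicalSpace Y] [CompactSpace Y] [T2Space Y]
    {F : Set (X → Y)} (hF : ∀ f ∈ F, Continuous f)
    [SecondCountableTopology (closure F)] : IsFragmentedFamily F := by
  intro A hA ε hε
  let : UniformSpace Y := uniformSpaceOfCompactR1
  rw [nhdsSet_diagonal_eq_uniformity] at hε
  obtain ⟨V₀, hV₀, hsymm, hcomp⟩ := comp_symm_mem_uniformity_sets hε
  obtain ⟨V, ⟨hV, hVclosed⟩, hVV₀⟩ := uniformity_hasBasis_closed.mem_iff.1 hV₀
  have hint : interior V ∈ 𝓤 Y := interior_mem_uniformity hV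
  obtain ⟨T, -, hT⟩ := isCompact_univ.elim_nhds_subcover
    (fun y : Y => {z | (z, y) ∈ interior V}) (fun y _ => mem_nhds_right y hint)
  have : CompactSpace (closure F) :=
    isCompact_iff_compactSpace.1 isClosed_closure.isCompact
  let B := TopologicalSpace.countableBasis (closure F)
  have hB : TopologicalSpace.IsTopologicalBasis B :=
    TopologicalSpace.isBasis_countableBasis (closure F)
  have : Countable B := (TopologicalSpace.countable_countableBasis (closure F)).to_subtype
  let ι := {D : Finset (B × T) // ∀ e : closure F, ∃ p ∈ D, e ∈ (p.1 : Set (closure F))}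
  let P : ι → Set X := fun D => {x | ∀ p ∈ D.1, ∀ e : closure F, e.1 ∈ F →
    e ∈ (p.1 : Set (closure F)) → (e.1 x, (p.2 : Y)) ∈ V}
  have hPclosed : ∀ D, IsClosed (P D) := by
    intro D
    simp only [P, ofPred_forall]
    refine isClosed_iInter fun p => isClosed_iInter fun _ => isClosed_iInter fun e =>
      isClosed_iInter fun he => isClosed_iInter fun _ => ?_
    exact hVclosed.preimage ((hF _ he).prodMk continuous_const)
  have hPcover : ∀ x, ∃ D, x ∈ P D := by
    intro x
    have key : ∀ e : closure F, ∃ p : B × T, e ∈ (p.1 : Set (closure F)) ∧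
        ∀ e' ∈ (p.1 : Set (closure F)), (e'.1 x, (p.2 : Y)) ∈ V := by
      intro e
      obtain ⟨y, hy, hey⟩ := mem_iUnion₂.1 (hT (mem_univ (e.1 x)))
      have hopen : IsOpen {e' : closure F | (e'.1 x, y) ∈ interior V} :=
        isOpen_interior.preimage
          (((continuous_apply x).comp continuous_subtype_val).prodMk continuous_const)
      obtain ⟨b, hb, heb, hbs⟩ := hB.exists_subset_of_mem_open
        (show e ∈ {e' : closure F | (e'.1 x, y) ∈ interior V} from hey) hopen
      exact ⟨(⟨b, hb⟩, ⟨y, hy⟩), heb, fun e' he' => interior_subset (hbs he')⟩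
    choose p hp hpV using key
    obtain ⟨t, -, ht⟩ := isCompact_univ.elim_nhds_subcover
      (fun e => ((p e).1 : Set (closure F)))
      (fun e _ => (hB.isOpen (p e).1.2).mem_nhds (hp e))
    classical
    refine ⟨⟨t.image p, fun e => ?_⟩, ?_⟩
    · obtain ⟨e', he't, he'⟩ := mem_iUnion₂.1 (ht (mem_univ e))
      exact ⟨p e', Finset.mem_image_of_mem p he't, he'⟩
    · intro q hq e _ he
      obtain ⟨e', -, rfl⟩ := Finset.mem_image.1 hq
      exact hpV e' e he
  have : CompactSpace (closure A) :=
    isCompact_iff_compactSpace.1 isClosed_closure.isCompact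
  have : Nonempty (closure A) := hA.closure.to_subtype
  obtain ⟨D, hD⟩ := nonempty_interior_of_iUnion_of_closed
    (f := fun D => ((↑) : closure A → X) ⁻¹' P D)
    (fun D => (hPclosed D).preimage continuous_subtype_val)
    (eq_univ_of_forall fun x => mem_iUnion.2 (hPcover x))
  obtain ⟨O, hO, hOeq⟩ := isOpen_induced_iff.1
    (isOpen_interior (s := ((↑) : closure A → X) ⁻¹' P D))
  have hOP : ∀ a ∈ O ∩ A, a ∈ P D := by
    rintro a ⟨haO, haA⟩
    have : (⟨a, subset_closure haA⟩ : closure A) ∈ ((↑) : closure A → X) ⁻¹' O := haO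
    rw [hOeq] at this
    exact interior_subset (s := ((↑) : closure A → X) ⁻¹' P D) this
  refine ⟨O, hO, ?_, ?_⟩
  · obtain ⟨z, hz⟩ := hD
    rw [← hOeq] at hz
    exact mem_closure_iff.1 z.2 O hO hz
  · intro f hf a ha b hb
    obtain ⟨p, hpD, hp⟩ := D.2 ⟨f, subset_closure hf⟩
    have h₁ := hVV₀ (hOP a ha p hpD ⟨f, subset_closure hf⟩ hf hp)
    have h₂ := hVV₀ (hOP b hb p hpD ⟨f, subset_closure hf⟩ hf hp)
    exact hcomp ⟨p.2, h₁, hsymm.symm _ _ h₂⟩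

open Set Topology in
/-- For a fragmented family on a second countable space, the domain is a countable union of sets
all of whose images under the family are simultaneously small. -/
theorem IsFragmentedFamily.exists_countable_cover {X Y : Type*} [TopologicalSpace X]
    [SecondCountableTopology X] [TopologicalSpace Y] {F : Set (X → Y)}
    (hF : IsFragmentedFamily F) {ε : Set (Y × Y)} (hε : ε ∈ nhdsSet (diagonal Y)) :
    ∃ 𝒞 : Set (Set X), 𝒞.Countable ∧ ⋃₀ 𝒞 = univ ∧
      ∀ C ∈ 𝒞, ∀ f ∈ F, ∀ a ∈ C, ∀ b ∈ C, (f a, f b) ∈ ε := by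
  let Good : Set X → Prop := fun U => ∃ 𝒞 : Set (Set X), 𝒞.Countable ∧ U ⊆ ⋃₀ 𝒞 ∧
      ∀ C ∈ 𝒞, ∀ f ∈ F, ∀ a ∈ C, ∀ b ∈ C, (f a, f b) ∈ ε
  let B := TopologicalSpace.countableBasis X
  have hB : TopologicalSpace.IsTopologicalBasis B := TopologicalSpace.isBasis_countableBasis X
  let G := {b ∈ B | Good b}
  have hG : G.Countable := (TopologicalSpace.countable_countableBasis X).mono (sep_subset _ _)
  have hUG : Good (⋃₀ G) := by
    have : ∀ b : G, Good b := fun b => b.2.2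
    choose 𝒞 h𝒞 hcov hsmall using this
    have := hG.to_subtype
    refine ⟨⋃ b, 𝒞 b, countable_iUnion h𝒞, ?_, ?_⟩
    · rintro x ⟨b, hb, hx⟩
      obtain ⟨C, hC, hxC⟩ := hcov ⟨b, hb⟩ hx
      exact ⟨C, mem_iUnion.2 ⟨_, hC⟩, hxC⟩
    · intro C hC
      obtain ⟨b, hb⟩ := mem_iUnion.1 hC
      exact hsmall b C hb
  have huniv : ⋃₀ G = univ := by
    by_contra hne
    obtain ⟨O, hO, ⟨x, hxO, hxG⟩, hsmall⟩ :=
      hF (⋃₀ G)ᶜ (nonempty_compl.2 hne) ε hε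
    obtain ⟨b, hb, hxb, hbO⟩ := hB.exists_subset_of_mem_open hxO hO
    obtain ⟨𝒞, h𝒞, hcov, hs⟩ := hUG
    refine hxG ⟨b, ⟨hb, insert (O ∩ (⋃₀ G)ᶜ) 𝒞, h𝒞.insert _, ?_, ?_⟩, hxb⟩
    · intro y hy
      by_cases hyG : y ∈ ⋃₀ G
      · obtain ⟨C, hC, hyC⟩ := hcov hyG
        exact ⟨C, mem_insert_of_mem _ hC, hyC⟩
      · exact ⟨_, mem_insert _ _, hbO hy, hyG⟩
    · rintro C (rfl | hC)
      · exact hsmall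
      · exact hs C hC
  obtain ⟨𝒞, h𝒞, hcov, hs⟩ := hUG
  exact ⟨𝒞, h𝒞, univ_subset_iff.1 (huniv ▸ hcov), hs⟩

open Set Topology in
/-- The pointwise closure of a fragmented family from a second countable space to a compact
metrizable space is metrizable. -/
theorem IsFragmentedFamily.metrizableSpace_closure {X Y : Type*} [TopologicalSpace X]
    [SecondCountableTopology X] [TopologicalSpace Y] [CompactSpace Y]
    [TopologicalSpace.MetrizableSpace Y] {F : Set (X → Y)} (hF : IsFragmentedFamily F) :
    TopologicalSpace.MetrizableSpace (closure F) := by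
  let : MetricSpace Y := TopologicalSpace.metrizableSpaceMetric Y
  have hε : ∀ n : ℕ, {p : Y × Y | dist p.1 p.2 ≤ 1 / ((n : ℝ) + 1)} ∈ nhdsSet (diagonal Y) := by
    intro n
    rw [nhdsSet_diagonal_eq_uniformity]
    exact Metric.uniformity_basis_dist_le.mem_of_mem Nat.one_div_pos_of_nat
  choose 𝒞 h𝒞 hcov hsmall using fun n => hF.exists_countable_cover (hε n)
  have hsel : ∀ C : Set X, ∃ t : Set X, t.Countable ∧ t ⊆ C ∧ (C.Nonempty → t.Nonempty) := by
    intro C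
    rcases C.eq_empty_or_nonempty with rfl | ⟨x, hx⟩
    · exact ⟨∅, countable_empty, Subset.rfl, id⟩
    · exact ⟨{x}, countable_singleton x, singleton_subset_iff.2 hx, fun _ => singleton_nonempty x⟩
  choose t htc htC htne using hsel
  let D : Set X := ⋃ n, ⋃ C ∈ 𝒞 n, t C
  have hD : D.Countable := countable_iUnion fun n => (h𝒞 n).biUnion fun C _ => htc C
  have := hD.to_subtype
  have : CompactSpace (closure F) :=
    isCompact_iff_compactSpace.1 isClosed_closure.isCompact
  let r : closure F → D → Y := fun e d => e.1 d
  have hr : Continuous r :=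
    continuous_pi fun d => (continuous_apply (d : X)).comp continuous_subtype_val
  have hclose : ∀ (n : ℕ), ∀ x, ∃ d ∈ D, ∀ e ∈ closure F,
      dist (e x) (e d) ≤ 1 / ((n : ℝ) + 1) := by
    intro n x
    obtain ⟨C, hC, hx⟩ := (hcov n).symm ▸ mem_univ x
    obtain ⟨d, hd⟩ := htne C ⟨x, hx⟩
    refine ⟨d, mem_iUnion.2 ⟨n, mem_iUnion₂.2 ⟨C, hC, hd⟩⟩, ?_⟩
    exact closure_minimal (fun f hf => hsmall n C hC f hf x hx d (htC C hd))
      (isClosed_le ((continuous_apply x).dist (continuous_apply d)) continuous_const)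
  have hinj : Function.Injective r := by
    intro p q hpq
    refine Subtype.ext (funext fun x => ?_)
    refine dist_le_zero.1 (le_of_forall_pos_le_add fun δ hδ => ?_)
    obtain ⟨n, hn⟩ := exists_nat_one_div_lt (half_pos hδ)
    obtain ⟨d, hd, h⟩ := hclose n x
    have hpqd : p.1 d = q.1 d := congrFun hpq ⟨d, hd⟩
    have hp := h p.1 p.2
    have hq := h q.1 q.2
    rw [← hpqd] at hq
    linarith [dist_triangle_right (p.1 x) (q.1 x) (p.1 d)]
  exact (hr.isClosedEmbedding hinj).isEmbedding.metrizableSpace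

/-- for a monoid `S` acting with continuous translations on a compact
Hausdorff space `X`, metrizability of `E(X)` implies that the translations form a
fragmented family (the system is HNS); and when `X` is metrizable the two conditions are
equivalent. -/
theorem stmt18 {S X : Type*} [Monoid S] [TopologicalSpace X] [CompactSpace X] [T2Space X]
    [MulAction S X]
    (hc : ∀ s : S, Continuous fun x : X => s • x) :
    (TopologicalSpace.MetrizableSpace (envSet S X) →
      IsFragmentedFamily {f : X → X | ∃ s : S, f = fun x => s • x}) ∧
    (TopologicalSpace.MetrizableSpace X →
      (TopologicalSpace.MetrizableSpace (envSet S X) ↔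
        IsFragmentedFamily {f : X → X | ∃ s : S, f = fun x => s • x})) := by
  have hforward : TopologicalSpace.MetrizableSpace (envSet S X) →
      IsFragmentedFamily {f : X → X | ∃ s : S, f = fun x => s • x} := by
    intro hE
    have : CompactSpace (envSet S X) := isCompact_iff_compactSpace.1 isClosed_closure.isCompact
    let : MetricSpace (envSet S X) := TopologicalSpace.metrizableSpaceMetric _
    have : SecondCountableTopology (closure {f : X → X | ∃ s : S, f = fun x => s • x}) :=
      inferInstanceAs (SecondCountableTopology (envSet S X))
    refine isFragmentedFamily_of_secondCountable_closure ?_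
    rintro _ ⟨s, rfl⟩
    exact hc s
  refine ⟨hforward, fun hX => ⟨hforward, fun hF => ?_⟩⟩
  let : MetricSpace X := TopologicalSpace.metrizableSpaceMetric X
  exact hF.metrizableSpace_closure
end
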